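/- ∫_{−1}^{1} ( π/(2·|sin(πz/2)|) − 1/|z| ) dz = −2·log(π/4). -/

import Mathlib

/-- The antiderivative of `π / (2 sin (π z / 2)) - 1 / z` on `(0, 1)`, equal there to
`log (tan (π z / 4) / z)` and extended continuously to `z = 0`. -/
noncomputable def logTanDiv (z : ℝ) : ℝ :=
  Real.log (Real.pi / 4 * Real.sinc (Real.pi / 4 * z)) - Real.log (Real.cos (Real.pi / 4 * z))

theorem continuousOn_logTanDiv : ContinuousOn logTanDiv (Set.Icc 0 1) := by
  have hpi := Real.pi_pos
  refine ContinuousOn.sub (ContinuousOn.log ?_ ?_) (ContinuousOn.log (by fun_prop) ?_)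
  · exact (continuous_const.mul (Real.continuous_sinc.comp (by fun_prop))).continuousOn
  · rintro z ⟨h0, h1⟩
    refine mul_ne_zero (by positivity) ?_
    rcases h0.eq_or_lt with rfl | h0
    · simp
    · have hz : 0 < Real.pi / 4 * z := by positivity
      rw [Real.sinc_of_ne_zero hz.ne']
      exact (div_pos (Real.sin_pos_of_pos_of_lt_pi hz (by nlinarith)) hz).ne'
  · rintro z ⟨h0, h1⟩
    exact (Real.cos_pos_of_mem_Ioo ⟨by nlinarith, by nlinarith⟩).ne'

theorem hasDerivAt_logTanDiv {z : ℝ} (hz : z ∈ Set.Ioo (0 : ℝ) 1) :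
    HasDerivAt logTanDiv (Real.pi/(2*|Real.sin (Real.pi*z/2)|) - 1/|z|) z := by
  obtain ⟨h0, h1⟩ := hz
  have hpi := Real.pi_pos
  have hpos : 0 < Real.pi / 4 * z := by positivity
  have hsin : 0 < Real.sin (Real.pi / 4 * z) :=
    Real.sin_pos_of_pos_of_lt_pi hpos (by nlinarith)
  have hcos : 0 < Real.cos (Real.pi / 4 * z) :=
    Real.cos_pos_of_mem_Ioo ⟨by nlinarith, by nlinarith⟩
  have hdouble : Real.sin (Real.pi * z / 2) =
      2 * Real.sin (Real.pi / 4 * z) * Real.cos (Real.pi / 4 * z) := by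
    rw [← Real.sin_two_mul]
    congr 1
    ring
  have hlin : HasDerivAt (fun x : ℝ => Real.pi / 4 * x) (Real.pi / 4) z := by
    simpa using (hasDerivAt_id z).const_mul (Real.pi / 4)
  have hderiv := ((hlin.sin.div (hasDerivAt_id z) h0.ne').log
    (div_pos hsin h0).ne').sub (hlin.cos.log hcos.ne')
  refine (hderiv.congr_deriv ?_).congr_of_eventuallyEq ?_
  · rw [hdouble, abs_of_pos (by positivity), abs_of_pos h0]
    simp only [id, Pi.div_apply]
    have hsq := Real.sin_sq_add_cos_sq (Real.pi / 4 * z)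
    generalize Real.sin (Real.pi / 4 * z) = s at *
    generalize Real.cos (Real.pi / 4 * z) = c at *
    field_simp
    linear_combination 4 * z * Real.pi * hsq
  · filter_upwards [lt_mem_nhds h0] with x hx
    have hx' : Real.pi / 4 * x ≠ 0 := by positivity
    simp only [logTanDiv, Real.sinc_of_ne_zero hx', Pi.sub_apply, Pi.div_apply, id]
    congr 2
    field_simp

theorem integrand_nonneg {z : ℝ} (hz : z ∈ Set.Ioo (0 : ℝ) 1) :
    0 ≤ Real.pi/(2*|Real.sin (Real.pi*z/2)|) - 1/|z| := by
  obtain ⟨h0, h1⟩ := hz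
  have hpi := Real.pi_pos
  have hpos : 0 < Real.pi * z / 2 := by positivity
  have hsin : 0 < Real.sin (Real.pi * z / 2) :=
    Real.sin_pos_of_pos_of_lt_pi hpos (by nlinarith)
  rw [abs_of_pos hsin, abs_of_pos h0, sub_nonneg, div_le_div_iff₀ h0 (by positivity)]
  linarith [Real.sin_lt hpos]

theorem intervalIntegrable_integrand :
    IntervalIntegrable (fun z : ℝ => Real.pi/(2*|Real.sin (Real.pi*z/2)|) - 1/|z|)
      MeasureTheory.volume 0 1 := by
  refine intervalIntegral.intervalIntegrable_deriv_of_nonneg (g := logTanDiv) ?_ ?_ ?_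
  · simpa using continuousOn_logTanDiv
  · intro z hz
    exact hasDerivAt_logTanDiv (by simpa using hz)
  · intro z hz
    exact integrand_nonneg (by simpa using hz)

theorem integral_zero_one_integrand :
    ∫ z in (0:ℝ)..1, (Real.pi/(2*|Real.sin (Real.pi*z/2)|) - 1/|z|)
      = -Real.log (Real.pi/4) := by
  rw [intervalIntegral.integral_eq_sub_of_hasDerivAt_of_le zero_le_one continuousOn_logTanDiv
    (fun z hz => hasDerivAt_logTanDiv hz) intervalIntegrable_integrand]
  have hpi : Real.pi / 4 ≠ 0 := by positivity
  have hone : Real.pi / 4 * Real.sinc (Real.pi / 4) = Real.cos (Real.pi / 4) := by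
    rw [Real.sinc_of_ne_zero hpi, mul_div_cancel₀ _ hpi, Real.sin_pi_div_four,
      Real.cos_pi_div_four]
  simp [logTanDiv, hone]

theorem sin_log_integral :
    ∫ z in (-1:ℝ)..1, (Real.pi/(2*|Real.sin (Real.pi*z/2)|) - 1/|z|)
      = -2 * Real.log (Real.pi/4) := by
  have heven : ∀ z : ℝ, Real.pi/(2*|Real.sin (Real.pi*(-z)/2)|) - 1/|-z| =
      Real.pi/(2*|Real.sin (Real.pi*z/2)|) - 1/|z| := fun z => by
    rw [mul_neg, neg_div, Real.sin_neg, abs_neg, abs_neg]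
  have hint : IntervalIntegrable (fun z : ℝ => Real.pi/(2*|Real.sin (Real.pi*z/2)|) - 1/|z|)
      MeasureTheory.volume (-1) 0 := by
    rw [IntervalIntegrable.iff_comp_neg]
    simpa only [heven, neg_zero, neg_neg] using intervalIntegrable_integrand.symm
  have hneg := intervalIntegral.integral_comp_neg (a := 0) (b := 1)
    (fun z : ℝ => Real.pi/(2*|Real.sin (Real.pi*z/2)|) - 1/|z|)
  simp only [heven, neg_zero] at hneg
  rw [← intervalIntegral.integral_add_adjacent_intervals hint intervalIntegrable_integrand,
    ← hneg, integral_zero_one_integrand]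
  ring
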